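/- arXiv:1607.02883 — 4 statements merged into one kernel-verified Lean document; each statement's English description precedes it below -/
import Mathlib

section
/- For any λ > 0 and any z ∈ ℝ with |z| ≠ λ, the unique global minimizer over γ ∈ ℝ of the hard-thresholding objective f(γ) = (z − γ)² + λ² − (|γ| − λ)²·1{|γ| < λ} is γ̂ = z·1{|z| > λ}; that is, the penalized least-squares problem with the hard thresholding penalty p_λ(|γ|) = λ² − (|γ| − λ)²·1{|γ| < λ} yields the hard thresholding rule γ̂(z) = z·1{|z| > λ}. -/
/-- For the penalized least-squares problem with the hard thresholding
penalty `p_λ(|γ|) = λ² − (|γ| − λ)²·1{|γ| < λ}`, for any `λ > 0` and any `z ∈ ℝ` with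
`|z| ≠ λ`, the unique global minimizer of
`f(γ) = (z − γ)² + λ² − (|γ| − λ)²·1{|γ| < λ}` is `γ̂ = z·1{|z| > λ}`. -/
theorem hard_thresholding_solution (lam z : ℝ) (hlam : 0 < lam) (hz : |z| ≠ lam) :
    ∀ γ : ℝ, γ ≠ (if lam < |z| then z else 0) →
      (z - (if lam < |z| then z else 0))^2 + lam^2 -
          (if |(if lam < |z| then z else 0)| < lam
            then (|(if lam < |z| then z else 0)| - lam)^2 else 0)
        < (z - γ)^2 + lam^2 - (if |γ| < lam then (|γ| - lam)^2 else 0) := by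
  intro γ hγ
  have hzg : z * γ ≤ |z| * |γ| := by
    rw [← abs_mul]; exact le_abs_self _
  have hz2 : |z| ^ 2 = z ^ 2 := sq_abs z
  have hg2 : |γ| ^ 2 = γ ^ 2 := sq_abs γ
  have hg0 := abs_nonneg γ
  have hz0 := abs_nonneg z
  by_cases h : lam < |z|
  · simp only [if_pos h] at hγ ⊢
    rw [if_neg (not_lt.mpr h.le)]
    by_cases hg : |γ| < lam
    · rw [if_pos hg]
      nlinarith [mul_pos (sub_pos.mpr h) (sub_pos.mpr hg), pow_pos (sub_pos.mpr h) 2]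
    · rw [if_neg hg]
      have : 0 < (z - γ) ^ 2 := (sq_pos_iff).mpr (sub_ne_zero.mpr (Ne.symm hγ))
      linarith
  · have h' : |z| < lam := lt_of_le_of_ne (not_lt.mp h) hz
    simp only [if_neg h] at hγ ⊢
    rw [abs_zero, if_pos hlam]
    by_cases hg : |γ| < lam
    · rw [if_pos hg]
      have := mul_pos (sub_pos.mpr h') (abs_pos.mpr hγ)
      nlinarith
    · rw [if_neg hg]
      nlinarith [sq_nonneg (z - γ)]
end

section
/- Let λ > 0 and a > 2, and let p_λ be the SCAD penalty. For every z ∈ ℝ, the function γ ↦ (1/2)(z − γ)² + p_λ(|γ|) attains its global minimum over ℝ at γ̂(z) = sgn(z)(|z| − λ)₊ if |z| ≤ 2λ; γ̂(z) = ((a − 1)z − sgn(z) a λ)/(a − 2) if 2λ < |z| ≤ aλ; and γ̂(z) = z if |z| > aλ. -/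
/-- The derivative of the SCAD penalty with parameters `lam > 0` and `a > 2`:
`p'_λ(s) = λ[1{s ≤ λ} + ((aλ − s)₊/((a − 1)λ))·1{s > λ}]`. -/
noncomputable def scadDeriv (lam a s : ℝ) : ℝ :=
  lam * ((if s ≤ lam then 1 else 0) +
    (max (a * lam - s) 0 / ((a - 1) * lam)) * (if lam < s then 1 else 0))

/-- The SCAD penalty `p_λ(t) = ∫₀ᵗ p'_λ(s) ds`. -/
noncomputable def scad (lam a t : ℝ) : ℝ := ∫ s in (0:ℝ)..t, scadDeriv lam a s

lemma scadDeriv_eq (lam a : ℝ) (hlam : 0 < lam) (ha : 2 < a) (s : ℝ) :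
    scadDeriv lam a s = min lam (max (a * lam - s) 0 / (a - 1)) := by
  unfold scadDeriv
  have h1 : 0 < a - 1 := by linarith
  by_cases h : s ≤ lam
  · rw [if_pos h, if_neg (not_lt.mpr h), min_eq_left]
    · ring
    · rw [le_div_iff₀ h1]
      exact le_max_of_le_left (by nlinarith)
  · rw [if_neg h, if_pos (not_le.mp h), min_eq_right]
    · field_simp
      ring
    · rw [div_le_iff₀ h1]
      push Not at h
      exact max_le (by nlinarith) (by positivity)

lemma scadDeriv_cont (lam a : ℝ) (hlam : 0 < lam) (ha : 2 < a) :
    Continuous (scadDeriv lam a) := by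
  have : scadDeriv lam a = fun s => min lam (max (a * lam - s) 0 / (a - 1)) :=
    funext (scadDeriv_eq lam a hlam ha)
  rw [this]
  fun_prop

lemma scadDeriv_slope (lam a : ℝ) (hlam : 0 < lam) (ha : 2 < a) (s t : ℝ) (h : s ≤ t) :
    scadDeriv lam a s - (t - s) ≤ scadDeriv lam a t := by
  rw [scadDeriv_eq lam a hlam ha, scadDeriv_eq lam a hlam ha]
  have h1 : 0 < a - 1 := by linarith
  refine le_min ?_ ?_
  · have := min_le_left lam (max (a * lam - s) 0 / (a - 1))
    linarith
  · have := min_le_right lam (max (a * lam - s) 0 / (a - 1))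
    have h2 : max (a * lam - s) 0 ≤ max (a * lam - t) 0 + (t - s) := by
      apply max_le
      · linarith [le_max_left (a * lam - t) 0]
      · linarith [le_max_right (a * lam - t) 0]
    have h3 : max (a * lam - s) 0 / (a - 1) ≤ max (a * lam - t) 0 / (a - 1) + (t - s) := by
      rw [div_add' _ _ _ h1.ne', div_le_div_iff_of_pos_right h1]
      nlinarith
    linarith

lemma scad_lower (lam a : ℝ) (hlam : 0 < lam) (ha : 2 < a) (u t : ℝ) :
    scadDeriv lam a u * (t - u) - (t - u) ^ 2 / 2 ≤ scad lam a t - scad lam a u := by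
  have hc := scadDeriv_cont lam a hlam ha
  have hd : scad lam a t - scad lam a u = ∫ s in u..t, scadDeriv lam a s := by
    unfold scad
    exact intervalIntegral.integral_interval_sub_left
      (hc.intervalIntegrable _ _) (hc.intervalIntegrable _ _)
  have hc2 : Continuous (fun s : ℝ => scadDeriv lam a u - (s - u)) := by fun_prop
  have hI : ∫ s in u..t, (scadDeriv lam a u - (s - u)) =
      scadDeriv lam a u * (t - u) - (t - u) ^ 2 / 2 := by
    rw [intervalIntegral.integral_sub (by simp)
      ((by fun_prop : Continuous (fun s : ℝ => s - u)).intervalIntegrable _ _),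
      intervalIntegral.integral_sub ((by fun_prop : Continuous (fun s : ℝ => s)).intervalIntegrable _ _) (by simp)]
    simp
    ring
  rw [hd, ← hI]
  rcases le_total u t with h | h
  · apply intervalIntegral.integral_mono_on h (hc2.intervalIntegrable _ _)
      (hc.intervalIntegrable _ _)
    intro s hs
    exact scadDeriv_slope lam a hlam ha u s hs.1
  · rw [intervalIntegral.integral_symm t u, intervalIntegral.integral_symm t u]
    apply neg_le_neg
    apply intervalIntegral.integral_mono_on h (hc.intervalIntegrable _ _)
      (hc2.intervalIntegrable _ _)
    intro s hs
    have := scadDeriv_slope lam a hlam ha s u hs.2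
    linarith

lemma scad_key (lam a : ℝ) (hlam : 0 < lam) (ha : 2 < a) (z u g γ : ℝ) (hg : |g| = u)
    (hzg : (z - g) ^ 2 = (|z| - u) ^ 2)
    (h : 0 ≤ (u - |z| + scadDeriv lam a u) * (|γ| - u)) :
    (1/2) * (z - g)^2 + scad lam a |g| ≤ (1/2) * (z - γ)^2 + scad lam a |γ| := by
  have h1 := scad_lower lam a hlam ha u |γ|
  have h2 : (|z| - |γ|) ^ 2 ≤ (z - γ) ^ 2 := by
    have := le_abs_self (z * γ)
    rw [abs_mul] at this
    nlinarith [sq_abs z, sq_abs γ]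
  rw [hg, hzg]
  nlinarith

lemma scad_sign (z u : ℝ) (hu : 0 ≤ u) (h0 : z = 0 → u = 0) :
    |Real.sign z * u| = u ∧ (z - Real.sign z * u) ^ 2 = (|z| - u) ^ 2 := by
  rcases lt_trichotomy z 0 with h | h | h
  · rw [Real.sign_of_neg h, abs_of_neg h]
    constructor
    · simp [abs_of_nonneg hu]
    · ring
  · simp [h, h0 h]
  · rw [Real.sign_of_pos h, abs_of_pos h]
    simp [abs_of_nonneg hu]

/-- for every `z`, the SCAD-penalized least squares objective
`γ ↦ (1/2)(z − γ)² + p_λ(|γ|)` attains its global minimum over `ℝ` at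
`γ̂(z) = sgn(z)(|z| − λ)₊` if `|z| ≤ 2λ`; `((a − 1)z − sgn(z)aλ)/(a − 2)` if
`2λ < |z| ≤ aλ`; and `z` if `|z| > aλ`. -/
theorem scad_penalized_ls_solution (lam a : ℝ) (hlam : 0 < lam) (ha : 2 < a) (z : ℝ) :
    ∀ γ : ℝ,
      (1/2) * (z - (if |z| ≤ 2 * lam then Real.sign z * max (|z| - lam) 0
          else if |z| ≤ a * lam then ((a - 1) * z - Real.sign z * a * lam) / (a - 2)
          else z))^2 +
        scad lam a |(if |z| ≤ 2 * lam then Real.sign z * max (|z| - lam) 0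
          else if |z| ≤ a * lam then ((a - 1) * z - Real.sign z * a * lam) / (a - 2)
          else z)|
      ≤ (1/2) * (z - γ)^2 + scad lam a |γ| := by
  intro γ
  have hz := abs_nonneg z
  have hγ := abs_nonneg γ
  have hsz : Real.sign z * |z| = z := by
    rcases lt_trichotomy z 0 with h | h | h
    · rw [Real.sign_of_neg h, abs_of_neg h]; ring
    · simp [h]
    · rw [Real.sign_of_pos h, abs_of_pos h]; ring
  have ha1 : 0 < a - 1 := by linarith
  have ha2 : 0 < a - 2 := by linarith
  split_ifs with h1 h2
  · obtain ⟨e1, e2⟩ := scad_sign z (max (|z| - lam) 0) (le_max_right _ _)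
      (by rintro rfl; simp [hlam.le])
    refine scad_key lam a hlam ha z _ _ γ e1 e2 ?_
    have hd : scadDeriv lam a (max (|z| - lam) 0) = lam := by
      have : max (|z| - lam) 0 ≤ lam := max_le (by linarith) hlam.le
      simp only [scadDeriv, if_pos this, if_neg (not_lt.mpr this)]
      ring
    rw [hd]
    rcases le_total lam |z| with h | h
    · rw [max_eq_left (by linarith)]
      apply le_of_eq
      ring
    · rw [max_eq_right (by linarith)]
      apply mul_nonneg <;> linarith
  · push Not at h1
    set u := ((a - 1) * |z| - a * lam) / (a - 2) with hu
    have hu' : u * (a - 2) = (a - 1) * |z| - a * lam := by rw [hu]; field_simp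
    have hul : lam < u := by rw [hu, lt_div_iff₀ ha2]; nlinarith
    have hua : u ≤ a * lam := by rw [hu, div_le_iff₀ ha2]; nlinarith
    have hge : ((a - 1) * z - Real.sign z * a * lam) / (a - 2) = Real.sign z * u := by
      rw [hu, ← mul_div_assoc]
      congr 1
      linear_combination (-(a - 1)) * hsz
    rw [hge]
    obtain ⟨e1, e2⟩ := scad_sign z u (by linarith)
      (by rintro rfl; simp at h1; linarith)
    refine scad_key lam a hlam ha z _ _ γ e1 e2 ?_
    have hd : scadDeriv lam a u = |z| - u := by
      simp only [scadDeriv, if_neg (not_le.mpr hul), if_pos hul]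
      rw [max_eq_left (by linarith)]
      field_simp
      linear_combination hu'
    rw [hd]
    apply le_of_eq
    ring
  · push Not at h1 h2
    refine scad_key lam a hlam ha z |z| z γ rfl (by ring) ?_
    have hd : scadDeriv lam a |z| = 0 := by
      have : lam < |z| := by linarith
      simp only [scadDeriv, if_neg (not_le.mpr this), if_pos this]
      rw [max_eq_right (by linarith)]
      simp
    rw [hd]
    simp
end

section
/- Let p : [0,∞) → [0,∞) be continuous and non-decreasing with p(0) = 0 and differentiable on (0,∞). If z ∈ ℝ satisfies |z| < inf_{t>0} (t + p'(t)), then γ = 0 is the unique global minimizer over ℝ of the penalized least-squares objective γ ↦ (1/2)(z − γ)² + p(|γ|). In particular, if the infimum of t + p'(t) over t > 0 is positive, then the penalized least-squares estimator is exactly zero (sparse) for all sufficiently small data values z. -/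
/-- Sparsity sufficient condition. Let `p : [0,∞) → [0,∞)` be continuous,
non-decreasing with `p(0) = 0`, differentiable on `(0,∞)`. If `|z| < inf_{t>0} (t + p'(t))`
then `γ = 0` is the unique global minimizer of `γ ↦ (1/2)(z − γ)² + p(|γ|)`. -/
theorem penalized_ls_sparsity (p : ℝ → ℝ)
    (hp_cont : ContinuousOn p (Set.Ici 0))
    (hp_mono : MonotoneOn p (Set.Ici 0))
    (hp_zero : p 0 = 0)
    (hp_nonneg : ∀ t, 0 ≤ t → 0 ≤ p t)
    (hp_diff : ∀ t, 0 < t → DifferentiableAt ℝ p t)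
    (z : ℝ)
    (hz : |z| < sInf {x : ℝ | ∃ t : ℝ, 0 < t ∧ x = t + deriv p t}) :
    ∀ γ : ℝ, γ ≠ 0 →
      (1/2) * (z - 0)^2 + p |(0 : ℝ)| < (1/2) * (z - γ)^2 + p |γ| := by
  intro γ hγ
  have hbdd : BddBelow {x : ℝ | ∃ t : ℝ, 0 < t ∧ x = t + deriv p t} := by
    by_contra h
    rw [Real.sInf_of_not_bddBelow h] at hz
    exact absurd hz (not_lt.mpr (abs_nonneg z))
  have ht : 0 < |γ| := abs_pos.mpr hγ
  obtain ⟨c, hc, hce⟩ := exists_hasDerivAt_eq_slope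
    (fun s : ℝ => s ^ 2 / 2 + p s) (fun s => s + deriv p s) ht
    (((continuous_id.pow 2).div_const 2).continuousOn.add
      (hp_cont.mono Set.Icc_subset_Ici_self))
    (by
      intro x hx
      have h1 : HasDerivAt (fun s : ℝ => s ^ 2 / 2) x x := by
        have h := (hasDerivAt_pow 2 x).div_const 2
        have e : ((2 : ℕ) : ℝ) * x ^ (2 - 1) / 2 = x := by
          norm_num
        rwa [e] at h
      exact h1.add (hp_diff x hx.1).hasDerivAt)
  have hlt : |z| < c + deriv p c := lt_of_lt_of_le hz (csInf_le hbdd ⟨c, hc.1, rfl⟩)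
  simp only [hp_zero, sub_zero] at hce
  rw [hce, lt_div_iff₀ ht] at hlt
  have h1 : z * γ ≤ |z| * |γ| := by
    rw [← abs_mul]
    exact le_abs_self _
  have h2 : |γ| ^ 2 = γ ^ 2 := sq_abs γ
  rw [abs_zero, hp_zero]
  nlinarith
end

section
/- Let P : [0,∞) → ℝ be concave and non-decreasing with continuous derivative P' on (0,∞), let d > 0, and let β, β₀ ∈ ℝ^s be vectors with |β_j| ≥ d and |β_{0j}| ≥ d for every j = 1, …, s. Then Σ_{j=1}^s [P(|β_j|) − P(|β_{0j}|)] ≥ −√s · P'(d) · ‖β − β₀‖, where ‖·‖ is the Euclidean norm. -/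
/-- penalty bound; version of Lemma B.1 of Fan and Liao (2014):
let `P : [0,∞) → ℝ` be concave and non-decreasing with continuous derivative on `(0,∞)`,
`d > 0`, and `β, β₀ ∈ ℝ^s` with all entries of absolute value at least `d`. Then
`Σ_j [P(|β_j|) − P(|β₀_j|)] ≥ −√s · P'(d) · ‖β − β₀‖`. -/
theorem penalty_change_lower_bound (P : ℝ → ℝ)
    (hconc : ConcaveOn ℝ (Set.Ici 0) P)
    (hmono : MonotoneOn P (Set.Ici 0))
    (hdiff : ∀ t : ℝ, 0 < t → DifferentiableAt ℝ P t)
    (hderiv_cont : ContinuousOn (deriv P) (Set.Ioi 0))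
    (d : ℝ) (hd : 0 < d) (s : ℕ)
    (β β₀ : EuclideanSpace ℝ (Fin s))
    (hβ : ∀ j : Fin s, d ≤ |β j|) (hβ₀ : ∀ j : Fin s, d ≤ |β₀ j|) :
    ∑ j : Fin s, (P |β j| - P |β₀ j|) ≥ -(Real.sqrt s * deriv P d * ‖β - β₀‖) := by
  have hS : ∀ x y : ℝ, 0 < x → x < y → P y - P x ≤ deriv P x * (y - x) := by
    intro x y hx hxy
    have h := hconc.slope_le_deriv (x := x) (y := y) (Set.mem_Ici.2 hx.le)
      (Set.mem_Ici.2 (hx.trans hxy).le) hxy (hdiff x hx)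
    rw [slope_def_field, div_le_iff₀ (sub_pos.2 hxy)] at h
    exact h
  have hD0 : 0 ≤ deriv P d := by
    have h := hS d (d + 1) hd (by linarith)
    have h2 := hmono (Set.mem_Ici.2 hd.le) (Set.mem_Ici.2 (by linarith : (0 : ℝ) ≤ d + 1))
      (by linarith)
    linarith
  have hanti : AntitoneOn (deriv P) (Set.Ioi 0) :=
    (hconc.subset Set.Ioi_subset_Ici_self (convex_Ioi 0)).antitoneOn_deriv
      (fun x hx => hdiff x hx)
  have hterm : ∀ j : Fin s, -(deriv P d * |β j - β₀ j|) ≤ P |β j| - P |β₀ j| := by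
    intro j
    have hb := hβ j
    have hb0 := hβ₀ j
    rcases le_or_gt |β₀ j| |β j| with h | h
    · have h1 := hmono (Set.mem_Ici.2 (abs_nonneg _)) (Set.mem_Ici.2 (abs_nonneg _)) h
      have h2 := mul_nonneg hD0 (abs_nonneg (β j - β₀ j))
      linarith
    · have hpos : 0 < |β j| := hd.trans_le hb
      have h1 := hS _ _ hpos h
      have h2 : deriv P |β j| ≤ deriv P d := hanti (Set.mem_Ioi.2 hd) (Set.mem_Ioi.2 hpos) hb
      have h3 : |β₀ j| - |β j| ≤ |β j - β₀ j| := by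
        rw [abs_sub_comm]; exact abs_sub_abs_le_abs_sub _ _
      have h4 := mul_le_mul h2 h3 (by linarith) hD0
      linarith
  have hl1 : ∑ j : Fin s, |β j - β₀ j| ≤ Real.sqrt s * ‖β - β₀‖ := by
    rw [EuclideanSpace.norm_eq, ← Real.sqrt_mul (Nat.cast_nonneg s)]
    apply Real.le_sqrt_of_sq_le
    have h := sq_sum_le_card_mul_sum_sq (s := Finset.univ) (f := fun j : Fin s => |β j - β₀ j|)
    simpa using h
  have hsum := Finset.sum_le_sum (fun j (_ : j ∈ Finset.univ) => hterm j)
  rw [Finset.sum_neg_distrib, ← Finset.mul_sum] at hsum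
  have := mul_le_mul_of_nonneg_left hl1 hD0
  have e : Real.sqrt s * deriv P d * ‖β - β₀‖ = deriv P d * (Real.sqrt s * ‖β - β₀‖) := by ring
  rw [e]
  linarith
end
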